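/- Let G be an amenable group. Then every finite cellular automaton on G that admits mutually erasable patterns also admits a garden of Eden (Moore's theorem for amenable groups). -/

import Mathlib

/-- A group is amenable if it carries a finitely additive, left-translation-invariant
probability measure defined on all subsets. -/
def IsAmenable (G : Type*) [Group G] : Prop :=
  ∃ μ : Set G → ℝ,
    (∀ A : Set G, 0 ≤ μ A) ∧
    μ Set.univ = 1 ∧
    (∀ A B : Set G, Disjoint A B → μ (A ∪ B) = μ A + μ B) ∧
    (∀ (g : G) (A : Set G), μ ((g * ·) '' A) = μ A)

variable {G : Type*} [Group G]

/-- The evolution of the cellular automaton `θ : Q^S → Q`. -/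
def evolve (S : Finset G) {Q : Type*} (θ : (↥S → Q) → Q) (φ : G → Q) : G → Q :=
  fun x => θ (fun s => φ (x * (s : G)))

/-- The automaton `θ` admits a Garden of Eden: a pattern on a finite subset `Y ⊆ G`
to which no configuration in the image of the evolution restricts. -/
def HasGOE (S : Finset G) {Q : Type*} (θ : (↥S → Q) → Q) : Prop :=
  ∃ (Y : Finset G) (p : ↥Y → Q),
    ∀ φ : G → Q, ∃ y : ↥Y, evolve S θ φ (y : G) ≠ p y

/-- The automaton `θ` admits mutually erasable patterns: two configurations which agree
outside a nonempty finite set, differ somewhere, and have the same image under the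
evolution. -/
def HasMEP (S : Finset G) {Q : Type*} (θ : (↥S → Q) → Q) : Prop :=
  ∃ φ₁ φ₂ : G → Q, φ₁ ≠ φ₂ ∧ {x | φ₁ x ≠ φ₂ x}.Finite ∧
    evolve S θ φ₁ = evolve S θ φ₂

open scoped Pointwise

/-- An amenable group has no right-displacement-bounded injection of two copies of itself. -/
theorem IsAmenable.not_injective_of_mem_smul (hG : IsAmenable G) (K : Finset G)
    (f : G × Bool → G) (hf : Function.Injective f) (hK : ∀ x b, x⁻¹ * f (x, b) ∈ K) :
    False := by
  classical
  obtain ⟨μ, h0, h1, hadd, hinv⟩ := hG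
  set ν : Set G → ℝ := fun A => μ A⁻¹ with hν
  have ν_add : ∀ A B : Set G, Disjoint A B → ν (A ∪ B) = ν A + ν B := fun A B h => by
    simp only [hν, Set.union_inv]
    exact hadd _ _ (h.preimage _)
  have ν_empty : ν ∅ = 0 := by simpa using ν_add ∅ ∅ (by simp)
  have ν_inv : ∀ (g : G) (A : Set G), ν ((· * g) '' A) = ν A := fun g A => by
    simp only [hν]
    rw [← hinv g⁻¹ A⁻¹]
    congr 1
    ext x
    constructor
    · rintro ⟨a, ha, h⟩
      exact ⟨a⁻¹, by simpa using ha, by simpa using congrArg (·⁻¹) h⟩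
    · rintro ⟨a, ha, rfl⟩
      exact ⟨a⁻¹, ha, by simp⟩
  have ν_biUnion : ∀ (T : Finset G) (A : G → Set G), (∀ i j, i ≠ j → Disjoint (A i) (A j)) →
      ν (⋃ i ∈ T, A i) = ∑ i ∈ T, ν (A i) := fun T A hA => by
    induction T using Finset.induction_on with
    | empty => simpa using ν_empty
    | insert a T ha ih =>
      rw [Finset.set_biUnion_insert, ν_add, ih, Finset.sum_insert ha]
      simp only [Set.disjoint_iUnion_right]
      rintro i hi
      exact hA _ _ (by rintro rfl; exact ha hi)
  have ν_range : ∀ b, ν (Set.range fun x => f (x, b)) = 1 := fun b => by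
    let A : G → Set G := fun k => {x | x⁻¹ * f (x, b) = k}
    have hA : ∀ i j, i ≠ j → Disjoint (A i) (A j) := fun i j hij =>
      Set.disjoint_left.2 fun x hi hj => hij (hi.symm.trans hj)
    have hfA : ∀ k, ∀ x ∈ A k, x * k = f (x, b) := by
      rintro k x rfl
      simp
    have hB : ∀ i j, i ≠ j → Disjoint ((· * i) '' A i) ((· * j) '' A j) := by
      intro i j hij
      rw [Set.disjoint_left]
      rintro _ ⟨x, hx, rfl⟩ ⟨y, hy, hxy⟩
      simp only [hfA _ _ hx, hfA _ _ hy] at hxy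
      obtain rfl : y = x := congrArg Prod.fst (hf hxy)
      exact hij (hx.symm.trans hy)
    have e1 : (Set.range fun x => f (x, b)) = ⋃ k ∈ K, (· * k) '' A k := by
      ext y
      simp only [Set.mem_range, Set.mem_iUnion, Set.mem_image, exists_prop]
      constructor
      · rintro ⟨x, rfl⟩
        exact ⟨_, hK x b, x, rfl, by simp⟩
      · rintro ⟨k, -, x, hx, rfl⟩
        exact ⟨x, (hfA _ _ hx).symm⟩
    have e2 : (⋃ k ∈ K, A k) = Set.univ :=
      Set.eq_univ_of_forall fun x => Set.mem_biUnion (hK x b) rfl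
    rw [e1, ν_biUnion _ _ hB, Finset.sum_congr rfl fun k _ => ν_inv k (A k),
      ← ν_biUnion _ _ hA, e2]
    simpa [hν] using h1
  have hdisj : Disjoint (Set.range fun x => f (x, true)) (Set.range fun x => f (x, false)) := by
    rw [Set.disjoint_left]
    rintro _ ⟨x, rfl⟩ ⟨y, hxy⟩
    simpa using hf hxy
  have h2 := ν_add _ _ hdisj
  have h3 := ν_add _ (_)ᶜ (disjoint_compl_right
    (a := (Set.range fun x => f (x, true)) ∪ Set.range fun x => f (x, false)))
  have h4 : ν Set.univ = 1 := by simpa [hν] using h1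
  rw [Set.union_compl_self, h4, h2, ν_range, ν_range] at h3
  have := h0 (((Set.range fun x => f (x, true)) ∪ Set.range fun x => f (x, false))ᶜ)⁻¹
  simp only [hν] at h3
  linarith

/-- In an amenable group no finite set doubles all finite sets. -/
theorem IsAmenable.exists_card_mul_lt_two_mul [DecidableEq G] (hG : IsAmenable G)
    (K : Finset G) : ∃ F : Finset G, (F * K).card < 2 * F.card := by
  by_contra! h
  obtain ⟨f, hf, hfK⟩ := (Finset.all_card_le_biUnion_card_iff_exists_injective
    (fun p : G × Bool => p.1 • K)).1 fun s => by
      have hs : s ⊆ s.image Prod.fst ×ˢ Finset.univ := fun p hp =>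
        Finset.mem_product.2 ⟨Finset.mem_image_of_mem _ hp, Finset.mem_univ _⟩
      calc s.card ≤ (s.image Prod.fst).card * 2 := by
            simpa using Finset.card_le_card hs
        _ ≤ (s.image Prod.fst * K).card := by
            rw [mul_comm]; exact h _
        _ ≤ _ := Finset.card_le_card fun x hx => by
            obtain ⟨a, ha, k, hk, rfl⟩ := Finset.mem_mul.1 hx
            obtain ⟨p, hp, rfl⟩ := Finset.mem_image.1 ha
            exact Finset.mem_biUnion.2 ⟨p, hp, Finset.smul_mem_smul_finset hk⟩
  refine hG.not_injective_of_mem_smul K f hf fun x b => ?_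
  exact Finset.inv_smul_mem_iff.2 (hfK (x, b))

/-- Amenable groups satisfy Følner's condition. -/
theorem IsAmenable.exists_mul_card_mul_le [DecidableEq G] (hG : IsAmenable G)
    (K : Finset G) {m : ℕ} (hm : 0 < m) :
    ∃ F : Finset G, F.Nonempty ∧ m * (F * K).card ≤ (m + 1) * F.card := by
  by_contra! h
  have step : ∀ F : Finset G, (m + 1) * F.card ≤ m * (F * K).card := fun F => by
    rcases F.eq_empty_or_nonempty with rfl | hF
    · simp
    · exact (h F hF).le
  have iter : ∀ (n : ℕ) (F : Finset G),
      (m + 1) ^ n * F.card ≤ m ^ n * (F * K ^ n).card := fun n F => by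
    induction n with
    | zero => simp
    | succ n ih =>
      calc (m + 1) ^ (n + 1) * F.card = (m + 1) * ((m + 1) ^ n * F.card) := by ring
        _ ≤ (m + 1) * (m ^ n * (F * K ^ n).card) := by gcongr
        _ = m ^ n * ((m + 1) * (F * K ^ n).card) := by ring
        _ ≤ m ^ n * (m * (F * K ^ n * K).card) := Nat.mul_le_mul_left _ (step _)
        _ = m ^ (n + 1) * (F * K ^ (n + 1)).card := by rw [mul_assoc F, ← pow_succ]; ring
  have two : 2 * m ^ m ≤ (m + 1) ^ m := by
    have bernoulli := pow_add_mul_le_add_pow m.zero_le (2 * m + 1).zero_le m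
    rwa [Nat.cast_id, mul_one, mul_pow_sub_one hm.ne', ← two_mul] at bernoulli
  obtain ⟨F, hF⟩ := hG.exists_card_mul_lt_two_mul (K ^ m)
  have h1 := iter m F
  have h2 : m ^ m * (F * K ^ m).card < m ^ m * (2 * F.card) :=
    Nat.mul_lt_mul_of_pos_left hF (by positivity)
  nlinarith [Nat.mul_le_mul_right F.card two]

/-- A finite set contains a large subset whose left translates of `E` are disjoint. -/
theorem Finset.exists_pairwiseDisjoint_smul [DecidableEq G] (E F : Finset G)
    (hE : E.Nonempty) :
    ∃ N ⊆ F, (N : Set G).PairwiseDisjoint (fun g => g • E) ∧ F.card ≤ N.card * E.card ^ 2 := by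
  classical
  obtain ⟨N, hN, hmax⟩ := (F.powerset.filter fun N : Finset G =>
    (N : Set G).PairwiseDisjoint (fun g => g • E)).exists_max_image Finset.card
      ⟨∅, by simp⟩
  simp only [Finset.mem_filter, Finset.mem_powerset] at hN hmax
  refine ⟨N, hN.1, hN.2, ?_⟩
  have hsub : F ⊆ N * (E * E⁻¹) := fun x hx => by
    by_cases hxN : x ∈ N
    · obtain ⟨y, hy⟩ := hE
      exact Finset.mem_mul.2 ⟨x, hxN, 1, Finset.mem_mul.2
        ⟨y, hy, y⁻¹, Finset.inv_mem_inv hy, by simp⟩, by simp⟩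
    by_contra hx'
    have := hmax (insert x N) ⟨Finset.insert_subset hx hN.1, by
      rw [Finset.coe_insert]
      refine hN.2.insert fun g hg _ => Finset.disjoint_left.2 fun z hz hz' => hx' ?_
      obtain ⟨a, ha, rfl⟩ := Finset.mem_smul_finset.1 hz
      obtain ⟨b, hb, hab⟩ := Finset.mem_smul_finset.1 hz'
      refine Finset.mem_mul.2 ⟨g, hg, b * a⁻¹, Finset.mul_mem_mul hb (Finset.inv_mem_inv ha), ?_⟩
      simp only [smul_eq_mul] at hab
      rw [← mul_assoc, hab, mul_inv_cancel_right]⟩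
    rw [Finset.card_insert_of_notMem hxN] at this
    omega
  calc F.card ≤ (N * (E * E⁻¹)).card := Finset.card_le_card hsub
    _ ≤ N.card * (E * E⁻¹).card := Finset.card_mul_le
    _ ≤ N.card * (E.card * E⁻¹.card) := Nat.mul_le_mul_left _ Finset.card_mul_le
    _ = N.card * E.card ^ 2 := by rw [Finset.card_inv, sq]

theorem evolve_mul_left (S : Finset G) {Q : Type*} (θ : (↥S → Q) → Q) (φ : G → Q) (g x : G) :
    evolve S θ (fun y => φ (g * y)) x = evolve S θ φ (g * x) := by
  simp [evolve, mul_assoc]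

theorem evolve_congr (S : Finset G) {Q : Type*} (θ : (↥S → Q) → Q) {φ ψ : G → Q} {x : G}
    (h : ∀ s ∈ S, φ (x * s) = ψ (x * s)) : evolve S θ φ x = evolve S θ ψ x :=
  congrArg θ (funext fun s => h s s.2)

/-- Mutually erasable patterns give a finite pattern on `E` that can be removed from any
configuration, at any place, without changing its evolution. -/
theorem HasMEP.exists_erasable (S : Finset G) {Q : Type*} (θ : (↥S → Q) → Q)
    (h : HasMEP S θ) : ∃ (E : Finset G) (p : ↥E → Q), E.Nonempty ∧
      ∀ (φ : G → Q) (g : G), ∃ ψ : G → Q, evolve S θ ψ = evolve S θ φ ∧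
        (∀ x, g⁻¹ * x ∉ E → ψ x = φ x) ∧ (fun y : ↥E => ψ (g * y)) ≠ p := by
  classical
  obtain ⟨φ₁, φ₂, hne, hfin, hev⟩ := h
  set D : Finset G := hfin.toFinset with hD
  have memD : ∀ x, x ∈ D ↔ φ₁ x ≠ φ₂ x := fun x => by simp [hD]
  set E : Finset G := D ∪ (D ×ˢ S ×ˢ S).image (fun t => t.1 * t.2.1⁻¹ * t.2.2) with hE
  obtain ⟨d, hd⟩ := Function.ne_iff.1 hne
  have hdE : d ∈ E := Finset.mem_union_left _ ((memD d).2 hd)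
  refine ⟨E, fun y : ↥E => φ₁ y, ⟨d, hdE⟩, fun φ g => ?_⟩
  by_cases hφ : (fun y : ↥E => φ (g * y)) = fun y : ↥E => φ₁ y
  swap
  · exact ⟨φ, rfl, fun _ _ => rfl, hφ⟩
  have hφ' : ∀ y ∈ E, φ (g * y) = φ₁ y := fun y hy => congrFun hφ ⟨y, hy⟩
  set ψ : G → Q := fun x => if g⁻¹ * x ∈ E then φ₂ (g⁻¹ * x) else φ x with hψ
  have hψE : ∀ y ∈ E, ψ (g * y) = φ₂ y := fun y hy => by simp [hψ, hy]
  have hψD : ∀ y, y ∉ D → ψ (g * y) = φ (g * y) := fun y hy => by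
    by_cases hyE : y ∈ E
    · rw [hψE y hyE, hφ' y hyE]
      exact (not_not.1 (mt (memD y).2 hy)).symm
    · simp [hψ, hyE]
  refine ⟨ψ, ?_, fun x hx => by simp [hψ, hx], fun hp => ?_⟩
  · funext x
    obtain ⟨x, rfl⟩ : ∃ x', g * x' = x := ⟨g⁻¹ * x, by simp⟩
    rw [← evolve_mul_left, ← evolve_mul_left]
    by_cases hx : ∃ s ∈ S, x * s ∈ D
    · obtain ⟨s, hs, hxs⟩ := hx
      have hxE : ∀ t ∈ S, x * t ∈ E := fun t ht => Finset.mem_union_right _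
        (Finset.mem_image.2 ⟨(x * s, s, t), by simp [hs, ht, hxs], by simp⟩)
      calc _ = evolve S θ φ₂ x := evolve_congr S θ fun t ht => hψE _ (hxE t ht)
        _ = evolve S θ φ₁ x := by rw [hev]
        _ = _ := evolve_congr S θ fun t ht => (hφ' _ (hxE t ht)).symm
    · push Not at hx
      exact evolve_congr S θ fun s hs => hψD _ (hx s hs)
  · exact hd ((congrFun hp ⟨d, hdE⟩).symm.trans (hψE d hdE))

/-- Removing a removable pattern at disjoint places. -/
theorem exists_evolve_eq_forall_ne [DecidableEq G] (S : Finset G) {Q : Type*}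
    (θ : (↥S → Q) → Q) (E : Finset G) (p : ↥E → Q)
    (hp : ∀ (φ : G → Q) (g : G), ∃ ψ : G → Q, evolve S θ ψ = evolve S θ φ ∧
      (∀ x, g⁻¹ * x ∉ E → ψ x = φ x) ∧ (fun y : ↥E => ψ (g * y)) ≠ p)
    (N : Finset G) (hN : (N : Set G).PairwiseDisjoint (fun g => g • E)) (φ : G → Q) :
    ∃ ψ : G → Q, evolve S θ ψ = evolve S θ φ ∧
      ∀ g ∈ N, (fun y : ↥E => ψ (g * y)) ≠ p := by
  induction N using Finset.induction_on with
  | empty => exact ⟨φ, rfl, by simp⟩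
  | insert a N ha ih =>
    obtain ⟨ψ, hψ, hψN⟩ := ih (hN.subset (by simp))
    obtain ⟨χ, hχ, hχE, hχa⟩ := hp ψ a
    refine ⟨χ, hχ.trans hψ, fun g hg => ?_⟩
    rcases Finset.mem_insert.1 hg with rfl | hgN
    · exact hχa
    · have hdisj : Disjoint (g • E) (a • E) := hN (by simp [hgN]) (by simp)
        (by rintro rfl; exact ha hgN)
      convert hψN g hgN using 2 with y
      refine hχE _ fun hy => Finset.disjoint_left.1 hdisj
        (Finset.smul_mem_smul_finset y.2) (Finset.inv_smul_mem_iff.1 hy)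

/-- Counting the patterns on `F` by preimages that avoid a removable pattern on disjoint
translates of its support `E`. -/
theorem card_pow_mul_le_of_not_hasGOE [DecidableEq G] (S : Finset G) {Q : Type*} [Finite Q]
    (θ : (↥S → Q) → Q) (hGOE : ¬ HasGOE S θ) (E : Finset G) (p : ↥E → Q)
    (hp : ∀ (φ : G → Q) (g : G), ∃ ψ : G → Q, evolve S θ ψ = evolve S θ φ ∧
      (∀ x, g⁻¹ * x ∉ E → ψ x = φ x) ∧ (fun y : ↥E => ψ (g * y)) ≠ p)
    (N F F' : Finset G) (hN : (N : Set G).PairwiseDisjoint (fun g => g • E))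
    (hNF : N * E ⊆ F') (hF : F * S ⊆ F') :
    Nat.card Q ^ F.card * (Nat.card Q ^ E.card) ^ N.card ≤
      (Nat.card Q ^ E.card - 1) ^ N.card * Nat.card Q ^ F'.card := by
  classical
  have := Fintype.ofFinite Q
  have hex : ∀ u : ↥F → Q, ∃ ψ : G → Q, (∀ y : ↥F, evolve S θ ψ y = u y) ∧
      ∀ g ∈ N, (fun y : ↥E => ψ (g * y)) ≠ p := fun u => by
    simp only [HasGOE] at hGOE
    push Not at hGOE
    obtain ⟨φ, hφ⟩ := hGOE F u
    obtain ⟨ψ, hψ, hψN⟩ := exists_evolve_eq_forall_ne S θ E p hp N hN φ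
    exact ⟨ψ, fun y => by rw [hψ, hφ], hψN⟩
  choose ψ hψ hψN using hex
  let f : (↥F → Q) → (↥N → {v : ↥E → Q // v ≠ p}) × (↥(F' \ (N * E)) → Q) := fun u =>
    (fun g => ⟨fun y => ψ u (g * y), hψN u g g.2⟩, fun x => ψ u x)
  have hf : Function.Injective f := fun u v huv => by
    have hagree : ∀ x ∈ F', ψ u x = ψ v x := fun x hx => by
      by_cases hxN : x ∈ N * E
      · obtain ⟨g, hg, y, hy, rfl⟩ := Finset.mem_mul.1 hxN
        exact congrFun (congrArg Subtype.val (congrFun (congrArg Prod.fst huv) ⟨g, hg⟩)) ⟨y, hy⟩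
      · exact congrFun (congrArg Prod.snd huv) ⟨x, Finset.mem_sdiff.2 ⟨hx, hxN⟩⟩
    funext y
    rw [← hψ u, ← hψ v]
    exact evolve_congr S θ fun s hs => hagree _ (hF (Finset.mul_mem_mul y.2 hs))
  have hNE : (N * E).card = N.card * E.card := by
    rw [← smul_eq_mul, ← Finset.biUnion_smul_finset, Finset.card_biUnion hN]
    simp
  have hF' : F'.card = (F' \ (N * E)).card + E.card * N.card := by
    rw [mul_comm, ← hNE, Finset.card_sdiff_add_card_eq_card hNF]
  have hcard := Fintype.card_le_of_injective f hf
  simp only [Fintype.card_prod, Fintype.card_fun, Fintype.card_coe, ne_eq,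
    Fintype.card_subtype_compl, Fintype.card_subtype_eq] at hcard
  rw [Nat.card_eq_fintype_card, hF', pow_add, ← pow_mul, ← mul_assoc]
  exact Nat.mul_le_mul_right _ hcard

theorem Nat.exists_pow_pred_mul_lt_pow {a b : ℕ} (ha : 0 < a) (hb : 0 < b) :
    ∃ L, 0 < L ∧ (a - 1) ^ L * b < a ^ L := by
  obtain ⟨L, hL⟩ := exists_pow_lt_of_lt_one (K := ℚ) (x := 1 / b) (y := (a - 1) / a)
    (by positivity) (by rw [div_lt_one (by positivity)]; linarith)
  refine ⟨L, Nat.pos_of_ne_zero ?_, ?_⟩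
  · rintro rfl
    have : (1 : ℚ) / b ≤ 1 := by
      rw [div_le_one (by positivity)]; exact_mod_cast hb
    simp only [pow_zero] at hL
    linarith
  · rw [div_pow, div_lt_div_iff₀ (by positivity) (by positivity), one_mul] at hL
    have hcast : ((a - 1 : ℕ) : ℚ) = a - 1 := by push_cast [Nat.cast_pred ha]; ring
    rw [← hcast] at hL
    exact_mod_cast hL

theorem Nat.pow_pred_mul_pow_lt_pow {a b L d n : ℕ} (ha : 0 < a)
    (hL : (a - 1) ^ L * b < a ^ L) (hd : L * d ≤ n) (hn : 0 < n) :
    (a - 1) ^ n * b ^ d < a ^ n := by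
  rcases Nat.eq_zero_or_pos d with rfl | hd0
  · simpa using Nat.pow_lt_pow_left (Nat.pred_lt_self ha) hn.ne'
  obtain ⟨r, rfl⟩ := Nat.exists_eq_add_of_le hd
  calc (a - 1) ^ (L * d + r) * b ^ d = ((a - 1) ^ L * b) ^ d * (a - 1) ^ r := by ring
    _ ≤ ((a - 1) ^ L * b) ^ d * a ^ r := by gcongr; omega
    _ < (a ^ L) ^ d * a ^ r := by
        gcongr
    _ = a ^ (L * d + r) := by ring

/-- Moore's theorem for amenable groups: on an amenable group, every finite cellular
automaton admitting mutually erasable patterns admits a garden of Eden. -/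
theorem moore_of_amenable (G : Type*) [Group G] (hG : IsAmenable G)
    (S : Finset G) (Q : Type*) [Finite Q] (θ : (↥S → Q) → Q)
    (hMEP : HasMEP S θ) : HasGOE S θ := by
  classical
  by_contra hGOE
  obtain ⟨E, p, hE, hp⟩ := HasMEP.exists_erasable S θ hMEP
  have : Nonempty Q := hMEP.elim fun φ _ => ⟨φ 1⟩
  have hq : 0 < Nat.card Q := Nat.card_pos
  have ha : 0 < Nat.card Q ^ E.card := Nat.pow_pos hq
  have hEc : 0 < E.card ^ 2 := Nat.pow_pos hE.card_pos
  obtain ⟨L, hL0, hL⟩ := Nat.exists_pow_pred_mul_lt_pow ha hq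
  obtain ⟨F, hF, hFK⟩ := hG.exists_mul_card_mul_le (insert 1 (E ∪ S))
    (Nat.mul_pos hL0 hEc)
  obtain ⟨N, hNF, hN, hcard⟩ := Finset.exists_pairwiseDisjoint_smul E F hE
  set F' := F * insert 1 (E ∪ S) with hF'
  have hFF' : F ⊆ F' := Finset.subset_mul_left _ (by simp)
  obtain ⟨d, hd⟩ := Nat.exists_eq_add_of_le (Finset.card_le_card hFF')
  have key := card_pow_mul_le_of_not_hasGOE S θ hGOE E p hp N F F' hN
    (Finset.mul_subset_mul hNF fun x hx => by simp [hx])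
    (Finset.mul_subset_mul_left fun x hx => by simp [hx])
  have hN0 : 0 < N.card := by
    have := hF.card_pos
    by_contra! h
    simp_all
  have hdN : L * d ≤ N.card := by
    rw [hd] at hFK
    refine Nat.le_of_mul_le_mul_right (?_ : _ ≤ N.card * E.card ^ 2) hEc
    nlinarith
  rw [hd, pow_add, mul_left_comm] at key
  exact absurd (Nat.le_of_mul_le_mul_left key (Nat.pow_pos hq))
    (not_le.2 (Nat.pow_pred_mul_pow_lt_pow ha hL hdN hN0))
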